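/- Let K ∈ ℕ and ε > 0 be fixed constants. Let (G_n)_{n∈ℕ} be a sequence of finite graphs with G_n ∈ H(K) for every n and δ(G_n) → ∞ as n → ∞, and let p = p(n) ∈ [0,1] satisfy p(n) < 1/2 − (1/2 + ε)·√(log δ(G_n)/δ(G_n)) for all n. Then Φ(p(n), G_n) → 0 as n → ∞; that is, the probability that a p(n)-random initial set percolates in majority bootstrap percolation on G_n tends to 0. -/

import Mathlib

open SimpleGraph Filter

namespace MBP

/-- Degree of a vertex, via the cardinality of its neighbourhood. -/
noncomputable def deg {V : Type} (G : SimpleGraph V) (x : V) : ℕ :=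
  (G.neighborSet x).ncard

/-- Minimum degree. -/
noncomputable def minDeg {V : Type} (G : SimpleGraph V) : ℕ :=
  sInf (Set.range (deg G))

/-- Maximum degree. -/
noncomputable def maxDeg {V : Type} (G : SimpleGraph V) : ℕ :=
  sSup (Set.range (deg G))

/-- Ball of radius `ℓ` around `x`. -/
def ball {V : Type} (G : SimpleGraph V) (x : V) (ℓ : ℕ) : Set V :=
  {y | G.edist x y ≤ ℓ}

/-- Sphere of radius `ℓ` around `x` (for `ℓ ≥ 1` this is `B(x,ℓ) \ B(x,ℓ-1)`). -/
def sphere {V : Type} (G : SimpleGraph V) (x : V) (ℓ : ℕ) : Set V :=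
  {y | G.edist x y = ℓ}

/-- (P1) locally K-almost regular. -/
def P1 (K : ℕ) {V : Type} (G : SimpleGraph V) : Prop :=
  ∀ (x : V) (ℓ : ℕ), 1 ≤ ℓ → ∀ y ∈ sphere G x ℓ,
    |(deg G x : ℤ) - (deg G y : ℤ)| ≤ (K : ℤ) * ℓ

/-- (P2) K-bounded backwards expansion. -/
def P2 (K : ℕ) {V : Type} (G : SimpleGraph V) : Prop :=
  ∀ (x : V) (ℓ : ℕ), 1 ≤ ℓ → ∀ y ∈ sphere G x ℓ,
    (G.neighborSet y ∩ ball G x ℓ).ncard ≤ K * ℓ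

/-- `D` witnesses property (P3) (typical local structure and K-separation) at vertex `x`. -/
def P3At (K : ℕ) {V : Type} (G : SimpleGraph V) (x : V) (D : Set V) : Prop :=
  x ∉ D ∧ ∀ (ℓ : ℕ), 1 ≤ ℓ →
    ((D ∩ sphere G x ℓ).ncard ≤ K ^ (ℓ - 1) * (deg G x) ^ (ℓ - 1)) ∧
    (∀ y ∈ sphere G x ℓ \ D, (D ∩ G.neighborSet y).ncard ≤ K * ℓ) ∧
    (∀ y ∈ sphere G x ℓ \ D, ∀ z ∈ sphere G x ℓ \ D, y ≠ z →
      (G.neighborSet y ∩ G.neighborSet z ∩ (sphere G x (ℓ + 1) \ D)).ncard ≤ 1) ∧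
    (∀ y ∈ sphere G x ℓ \ D,
      (ball G y (2 * ℓ - 1) ∩ (sphere G x ℓ \ D)).ncard ≤ ℓ * K ^ (ℓ - 1) * (deg G x) ^ (ℓ - 1))

/-- (P3) typical local structure and K-separation. -/
def P3 (K : ℕ) {V : Type} (G : SimpleGraph V) : Prop :=
  ∀ x : V, ∃ D : Set V, P3At K G x D

/-- (P5) exponential order. -/
def P5 (K : ℕ) {V : Type} (G : SimpleGraph V) : Prop :=
  (Nat.card V : ℝ) ≤ Real.exp (K * minDeg G)

/-- (P4) K-projection, relative to a membership predicate `mem` for the projected subgraphs. -/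
def P4With (K : ℕ) {V : Type} (G : SimpleGraph V) (mem : G.Subgraph → Prop) : Prop :=
  ∀ (x : V) (ℓ : ℕ), 1 ≤ ℓ → ∀ y ∈ sphere G x ℓ,
    ∃ H : G.Subgraph, y ∈ H.verts ∧ mem H ∧
      H.verts ∩ ball G x (ℓ - 1) = ∅ ∧
      ∀ w : H.verts, |(deg H.coe w : ℤ) - (deg G (w : V) : ℤ)| ≤ (K : ℤ) * ℓ

/-- Membership in the class H(K) with recursion fuel `n`. -/
def HAux (K : ℕ) : ℕ → (V : Type) → SimpleGraph V → Prop
  | 0, V, _ => Nat.card V = 1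
  | n + 1, V, G =>
      Nat.card V = 1 ∨
        (P1 K G ∧ P2 K G ∧ P3 K G ∧ P4With K G (fun H => HAux K n H.verts H.coe) ∧ P5 K G)

/-- The class `H(K)` of geometric graphs: least class containing the one-vertex graph and
closed under properties (P1)–(P5), where the projections of (P4) again lie in the class. -/
def InH (K : ℕ) {V : Type} (G : SimpleGraph V) : Prop :=
  ∃ n, HAux K n V G

/-- One round of majority bootstrap percolation: a vertex `v` becomes infected if at least
`d(v)/2` of its neighbours are infected. -/
def bootStep {V : Type} (G : SimpleGraph V) (A : Set V) : Set V :=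
  A ∪ {v | (deg G v : ℝ) / 2 ≤ ((G.neighborSet v ∩ A).ncard : ℝ)}

/-- The majority bootstrap percolation process. -/
def bootIter {V : Type} (G : SimpleGraph V) (A0 : Set V) : ℕ → Set V
  | 0 => A0
  | n + 1 => bootStep G (bootIter G A0 n)

/-- `A0` percolates if eventually every vertex is infected. -/
def Percolates {V : Type} (G : SimpleGraph V) (A0 : Set V) : Prop :=
  (⋃ i, bootIter G A0 i) = Set.univ

/-- Weight of a subset `A` under the `p`-random measure. -/
noncomputable def weight {V : Type} (p : ℝ) (A : Set V) : ℝ :=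
  p ^ A.ncard * (1 - p) ^ (Aᶜ).ncard

/-- Probability that a `p`-random subset of `V` satisfies the event `E`. -/
noncomputable def prob {V : Type} (p : ℝ) (E : Set V → Prop) : ℝ :=
  ∑ᶠ A ∈ {A : Set V | E A}, weight p A

/-- Probability that a `p`-random initial set percolates. -/
noncomputable def Phi {V : Type} (p : ℝ) (G : SimpleGraph V) : ℝ :=
  prob p (fun A0 => Percolates G A0)

/-- One round of the `m`-shifted bootstrap process (threshold `d(v)/2 + m`). -/
def bootStepM {V : Type} (G : SimpleGraph V) (m : ℕ) (A : Set V) : Set V :=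
  A ∪ {v | (deg G v : ℝ) / 2 + m ≤ ((G.neighborSet v ∩ A).ncard : ℝ)}

/-- The `m`-shifted bootstrap process. -/
def bootIterM {V : Type} (G : SimpleGraph V) (m : ℕ) (A0 : Set V) : ℕ → Set V
  | 0 => A0
  | n + 1 => bootStepM G m (bootIterM G m A0 n)

/-- `σ(x) = √(log d(x) / d(x))`. -/
noncomputable def sigma' {V : Type} (G : SimpleGraph V) (x : V) : ℝ :=
  Real.sqrt (Real.log (deg G x) / (deg G x))

/-- `γ(x) = √(d(x) / √(log d(x)))`. -/
noncomputable def gamma' {V : Type} (G : SimpleGraph V) (x : V) : ℝ :=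
  Real.sqrt ((deg G x : ℝ) / Real.sqrt (Real.log (deg G x)))

/-- The `Boot₂(γ)` process: in the step from round `ℓ` to round `ℓ+1`, a vertex `v` becomes
infected if at least `d(v)/2 - max(0, 2-ℓ)·γ(v)` of its neighbours are infected. -/
noncomputable def hatIter {V : Type} (G : SimpleGraph V) (A0 : Set V) : ℕ → Set V
  | 0 => A0
  | ℓ + 1 =>
      hatIter G A0 ℓ ∪
        {v | (deg G v : ℝ) / 2 - ((2 - ℓ : ℕ) : ℝ) * gamma' G v
              ≤ ((G.neighborSet v ∩ hatIter G A0 ℓ).ncard : ℝ)}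

/-- Expectation of `f` restricted to the event `E`, under the `p`-random measure. -/
noncomputable def expOn {V : Type} (p : ℝ) (E : Set V → Prop) (f : Set V → ℝ) : ℝ :=
  ∑ᶠ A ∈ {A : Set V | E A}, weight p A * f A

/-- Conditional expectation of `f` given the event `E`. -/
noncomputable def condExp {V : Type} (p : ℝ) (E : Set V → Prop) (f : Set V → ℝ) : ℝ :=
  expOn p E f / prob p E

/-- Conditional variance of `f` given the event `E`. -/
noncomputable def condVar {V : Type} (p : ℝ) (E : Set V → Prop) (f : Set V → ℝ) : ℝ :=
  condExp p E (fun A => (f A - condExp p E f) ^ 2)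

/-- The number of edges between `U` and `W` (ordered pairs `(u,w)` with `u ∈ U`, `w ∈ W`
adjacent; for disjoint sets this is the number of edges with one endpoint in each). -/
noncomputable def eBetween {V : Type} (G : SimpleGraph V) (U W : Set V) : ℕ :=
  {e : V × V | e.1 ∈ U ∧ e.2 ∈ W ∧ G.Adj e.1 e.2}.ncard

/-- Upper tail `Pr[Bin(d,p) ≥ t]` of the binomial distribution. -/
noncomputable def binTail (d : ℕ) (p : ℝ) (t : ℝ) : ℝ :=
  ∑ k ∈ Finset.range (d + 1),
    if t ≤ (k : ℝ) then (d.choose k : ℝ) * p ^ k * (1 - p) ^ (d - k) else 0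

section helpers
open Finset
open scoped Classical

lemma hoeff (p h : ℝ) (hp0 : 0 ≤ p) (hp1 : p ≤ 1) :
    p * Real.exp h + (1 - p) ≤ Real.exp (p * h + h ^ 2 / 8) := by
  let μ : MeasureTheory.Measure ℝ :=
    ENNReal.ofReal p • MeasureTheory.Measure.dirac (1:ℝ) +
      ENNReal.ofReal (1 - p) • MeasureTheory.Measure.dirac (0:ℝ)
  have hμ : MeasureTheory.IsProbabilityMeasure μ := by
    constructor
    simp [μ, ← ENNReal.ofReal_add hp0 (sub_nonneg.2 hp1)]
  have hint : ∀ f : ℝ → ℝ, ∫ x, f x ∂μ = p * f 1 + (1 - p) * f 0 := by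
    intro f
    rw [MeasureTheory.integral_add_measure, MeasureTheory.integral_smul_measure,
      MeasureTheory.integral_smul_measure, MeasureTheory.integral_dirac,
      MeasureTheory.integral_dirac, ENNReal.toReal_ofReal hp0,
      ENNReal.toReal_ofReal (sub_nonneg.2 hp1)]
    · simp
    · exact (MeasureTheory.integrable_dirac (by simp)).smul_measure (by simp)
    · exact (MeasureTheory.integrable_dirac (by simp)).smul_measure (by simp)
  have hae : ∀ᵐ x ∂μ, (id x : ℝ) ∈ Set.Icc (0:ℝ) 1 := by
    rw [MeasureTheory.ae_add_measure_iff]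
    constructor <;> refine MeasureTheory.Measure.ae_smul_measure ?_ _ <;> simp [MeasureTheory.ae_dirac_eq]
  have key := (ProbabilityTheory.hasSubgaussianMGF_of_mem_Icc (μ := μ) (X := id)
    aemeasurable_id hae).mgf_le h
  rw [ProbabilityTheory.mgf, hint] at key
  rw [hint] at key
  simp at key
  have e1 : p * Real.exp h + (1 - p) =
      (p * Real.exp (h * (1 - p)) + (1 - p) * Real.exp (-(h * p))) * Real.exp (p * h) := by
    rw [add_mul, mul_assoc, mul_assoc, ← Real.exp_add, ← Real.exp_add]
    ring_nf
    simp
    ring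
  rw [e1, add_comm (p * h), Real.exp_add]
  gcongr
  refine key.trans (Real.exp_le_exp.2 (le_of_eq (by ring)))

set_option linter.unusedSectionVars false

variable {V : Type} [Fintype V]

lemma weight_nonneg {p : ℝ} (hp0 : 0 ≤ p) (hp1 : p ≤ 1) (A : Set V) : 0 ≤ weight p A :=
  mul_nonneg (pow_nonneg hp0 _) (pow_nonneg (sub_nonneg.2 hp1) _)

lemma prob_eq (p : ℝ) (E : Set V → Prop) :
    prob p E = ∑ A : Set V, if E A then weight p A else 0 := by
  unfold prob
  rw [finsum_eq_sum_of_fintype]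
  refine Finset.sum_congr rfl fun A _ => ?_
  rw [finsum_eq_if]
  rfl

lemma gen_fun (p : ℝ) (f : V → ℝ) :
    ∑ A : Set V, weight p A * ∏ u : V, (if u ∈ A then f u else 1) =
      ∏ u : V, (p * f u + (1 - p)) := by
  rw [Finset.prod_add, Finset.powerset_univ, ← (Fintype.finsetEquivSet (α := V)).sum_comp]
  refine Finset.sum_congr rfl fun t _ => ?_
  simp only [Fintype.finsetEquivSet_apply, Finset.mem_coe, weight, Finset.prod_mul_distrib,
    Finset.prod_const, Set.ncard_coe_finset]
  rw [← Finset.coe_compl, Set.ncard_coe_finset, Finset.prod_ite_mem]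
  simp [Finset.compl_eq_univ_sdiff]
  ring

lemma sum_weight (p : ℝ) : ∑ A : Set V, weight p A = 1 := by
  have := gen_fun (V := V) p (fun _ => 1)
  simpa using this

lemma prob_nonneg {p : ℝ} (hp0 : 0 ≤ p) (hp1 : p ≤ 1) (E : Set V → Prop) : 0 ≤ prob p E := by
  rw [prob_eq]
  refine Finset.sum_nonneg fun A _ => ?_
  split_ifs
  · exact weight_nonneg hp0 hp1 A
  · exact le_rfl

lemma prob_mono {p : ℝ} (hp0 : 0 ≤ p) (hp1 : p ≤ 1) {E F : Set V → Prop}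
    (h : ∀ A, E A → F A) : prob p E ≤ prob p F := by
  rw [prob_eq, prob_eq]
  refine Finset.sum_le_sum fun A _ => ?_
  have := weight_nonneg hp0 hp1 A
  by_cases hE : E A
  · simp [hE, h A hE]
  · rw [if_neg hE]; split_ifs <;> simp [this]

lemma prob_exists_le {ι : Type*} {p : ℝ} (hp0 : 0 ≤ p) (hp1 : p ≤ 1) (s : Finset ι)
    (E : ι → Set V → Prop) :
    prob p (fun A => ∃ i ∈ s, E i A) ≤ ∑ i ∈ s, prob p (E i) := by
  simp only [prob_eq]
  rw [Finset.sum_comm]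
  refine Finset.sum_le_sum fun A _ => ?_
  have hw := weight_nonneg hp0 hp1 A
  split_ifs with h
  · obtain ⟨i, hi, hE⟩ := h
    have := Finset.single_le_sum (f := fun i => if E i A then weight p A else 0)
      (fun j _ => by positivity) hi
    simpa [hE] using this
  · exact Finset.sum_nonneg fun j _ => by positivity

lemma prob_or_le {p : ℝ} (hp0 : 0 ≤ p) (hp1 : p ≤ 1) (E F : Set V → Prop) :
    prob p (fun A => E A ∨ F A) ≤ prob p E + prob p F := by
  simp only [prob_eq]
  rw [← Finset.sum_add_distrib]
  refine Finset.sum_le_sum fun A _ => ?_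
  have hw := weight_nonneg hp0 hp1 A
  by_cases h1 : E A <;> by_cases h2 : F A <;> simp [h1, h2, hw]

/-- Markov inequality for counting. -/
lemma prob_markov {p : ℝ} (hp0 : 0 ≤ p) (hp1 : p ≤ 1) (s : Finset V)
    (E : V → Set V → Prop) {t : ℝ} (ht : 0 < t) :
    prob p (fun A => t ≤ ((s.filter (fun y => E y A)).card : ℝ)) ≤
      (∑ y ∈ s, prob p (E y)) / t := by
  rw [le_div_iff₀ ht]
  simp only [prob_eq]
  rw [Finset.sum_comm, Finset.sum_mul]
  refine Finset.sum_le_sum fun A _ => ?_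
  have hw := weight_nonneg hp0 hp1 A
  split_ifs with h
  · rw [← Finset.sum_filter, Finset.sum_const, nsmul_eq_mul, mul_comm]
    gcongr
  · rw [zero_mul]
    exact Finset.sum_nonneg fun j _ => by positivity

/-- Hoeffding inequality for weighted sums. -/
lemma prob_hoeff {p : ℝ} (hp0 : 0 ≤ p) (hp1 : p ≤ 1) (w : V → ℝ) {t S W : ℝ}
    (hS : p * ∑ u, w u + t ≤ S) (ht : 0 ≤ t) (hW : 0 < W) (hwW : ∑ u, w u ^ 2 ≤ W) :
    prob p (fun A => S ≤ ∑ u, if u ∈ A then w u else 0) ≤ Real.exp (- (2 * t ^ 2 / W)) := by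
  set l := 4 * t / W with hl
  have hl0 : 0 ≤ l := by positivity
  have h1 : prob p (fun A => S ≤ ∑ u, if u ∈ A then w u else 0) ≤
      (∏ u : V, (p * Real.exp (l * w u) + (1 - p))) * Real.exp (- (l * S)) := by
    rw [← gen_fun, prob_eq, Finset.sum_mul]
    refine Finset.sum_le_sum fun A _ => ?_
    have hw := weight_nonneg hp0 hp1 A
    have e : ∏ u : V, (if u ∈ A then Real.exp (l * w u) else 1) =
        Real.exp (l * ∑ u, if u ∈ A then w u else 0) := by
      rw [Finset.mul_sum, Real.exp_sum]
      refine Finset.prod_congr rfl fun u _ => ?_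
      split_ifs <;> simp
    rw [e, mul_assoc, ← Real.exp_add]
    split_ifs with h
    · refine le_mul_of_one_le_right hw (Real.one_le_exp ?_)
      nlinarith
    · positivity
  have h2 : (∏ u : V, (p * Real.exp (l * w u) + (1 - p))) ≤
      Real.exp (l * (p * ∑ u, w u) + l ^ 2 * (∑ u, w u ^ 2) / 8) := by
    calc _ ≤ ∏ u : V, Real.exp (p * (l * w u) + (l * w u) ^ 2 / 8) := by
          refine Finset.prod_le_prod (fun u _ => ?_) (fun u _ => hoeff p _ hp0 hp1)
          have := sub_nonneg.2 hp1
          positivity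
      _ = _ := by
          rw [← Real.exp_sum]
          congr 1
          rw [Finset.sum_add_distrib, Finset.mul_sum, Finset.mul_sum, Finset.mul_sum,
            Finset.sum_div]
          congr 1 <;> refine Finset.sum_congr rfl fun u _ => by ring
  refine h1.trans ((mul_le_mul_of_nonneg_right h2 (Real.exp_pos _).le).trans ?_)
  rw [← Real.exp_add]
  apply Real.exp_le_exp.2
  have h3 : l * (p * ∑ u, w u) ≤ l * (S - t) := by gcongr; linarith
  have h4 : l ^ 2 * (∑ u, w u ^ 2) / 8 ≤ l ^ 2 * W / 8 := by gcongr
  have h5 : l ^ 2 * W / 8 - l * t = - (2 * t ^ 2 / W) := by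
    rw [hl]; field_simp; ring
  linarith

lemma ncard_sum (S : Set V) : (S.ncard : ℝ) = ∑ u : V, if u ∈ S then (1:ℝ) else 0 := by
  rw [Set.ncard_eq_toFinset_card', ← Finset.sum_filter]
  simp

lemma next_sphere {G : SimpleGraph V} {x y v : V} {l : ℕ} (hy : y ∈ sphere G x l)
    (hv : G.Adj y v) (hb : v ∉ ball G x l) : v ∈ sphere G x (l + 1) := by
  simp only [sphere, ball, Set.mem_ofPred_eq, not_le] at *
  refine le_antisymm ?_ ?_
  · refine (SimpleGraph.edist_triangle (v := y)).trans ?_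
    rw [hy, SimpleGraph.edist_eq_one_iff_adj.2 hv]
    simp
  · have := Order.add_one_le_of_lt hb
    simpa using this

lemma nbr_split {K : ℕ} {G : SimpleGraph V} {x v : V} {l : ℕ} (hl : 1 ≤ l) {D : Set V}
    (h2 : P2 K G) (h3 : P3At K G x D) (hv : v ∈ sphere G x l \ D) (A : Set V) :
    (G.neighborSet v ∩ A).ncard ≤
      (G.neighborSet v ∩ A ∩ (sphere G x (l + 1) \ D)).ncard + 2 * (K * l) := by
  have hsub : G.neighborSet v ∩ A ⊆ (G.neighborSet v ∩ A ∩ (sphere G x (l + 1) \ D)) ∪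
      ((G.neighborSet v ∩ ball G x l) ∪ (D ∩ G.neighborSet v)) := by
    rintro u ⟨hu, hA⟩
    by_cases hb : u ∈ ball G x l
    · exact Or.inr (Or.inl ⟨hu, hb⟩)
    by_cases hD : u ∈ D
    · exact Or.inr (Or.inr ⟨hD, hu⟩)
    exact Or.inl ⟨⟨hu, hA⟩, next_sphere hv.1 hu hb, hD⟩
  have e1 := Set.ncard_le_ncard hsub (Set.toFinite _)
  have e2 := Set.ncard_union_le (G.neighborSet v ∩ A ∩ (sphere G x (l + 1) \ D))
      ((G.neighborSet v ∩ ball G x l) ∪ (D ∩ G.neighborSet v))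
  have e3 := Set.ncard_union_le (G.neighborSet v ∩ ball G x l) (D ∩ G.neighborSet v)
  have e4 := h2 x l hl v hv.1
  have e5 := (h3.2 l hl).2.1 v hv
  omega

lemma leaf_bound {K : ℕ} {G : SimpleGraph V} {x : V} {D : Set V} {p : ℝ}
    (hp0 : 0 ≤ p) (hp1 : p ≤ 1) (h2 : P2 K G) (h3 : P3At K G x D) (g : V → ℝ)
    (L : Finset V) (hL : ∀ v ∈ L, v ∈ sphere G x 2 \ D) (hL0 : 0 < L.card)
    {τ R : ℝ} (hτ0 : 0 ≤ τ) (hR0 : 0 ≤ R)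
    (hτ : ∀ v ∈ L, τ ≤ (deg G v : ℝ) / 2 - 2 * g v - 4 * K - p * deg G v)
    (hR : ∀ v ∈ L, (deg G v : ℝ) ≤ R) :
    prob p (fun A => ∀ v ∈ L, (deg G v : ℝ) / 2 - 2 * g v ≤ ((G.neighborSet v ∩ A).ncard : ℝ)) ≤
      Real.exp (- (2 * (L.card * τ) ^ 2 / (L.card * (R + L.card)))) := by
  set T := sphere G x 3 \ D with hT
  let c : V → V → ℝ := fun v u => if u ∈ G.neighborSet v ∩ T then 1 else 0
  have hc : ∀ v, ∑ u, c v u = ((G.neighborSet v ∩ T).ncard : ℝ) := by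
    intro v
    rw [ncard_sum]
    refine Finset.sum_congr rfl fun u _ => ?_
    simp only [c]
    congr
  have hcd : ∀ v, ∑ u, c v u ≤ deg G v := by
    intro v
    rw [hc]
    exact_mod_cast Set.ncard_le_ncard Set.inter_subset_left (Set.toFinite _)
  have hLc : (0:ℝ) < L.card := by exact_mod_cast hL0
  have main := prob_hoeff hp0 hp1 (fun u => ∑ v ∈ L, c v u) (t := L.card * τ)
    (S := ∑ v ∈ L, ((deg G v : ℝ) / 2 - 2 * g v - 4 * K)) (W := L.card * (R + L.card))
    ?_ (by positivity) (by positivity) ?_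
  · refine le_trans (prob_mono hp0 hp1 ?_) main
    intro A hA
    have e : (∑ u, if u ∈ A then ∑ v ∈ L, c v u else 0) =
        ∑ v ∈ L, ((G.neighborSet v ∩ A ∩ T).ncard : ℝ) := by
      simp_rw [ncard_sum]
      rw [Finset.sum_comm]
      refine Finset.sum_congr rfl fun u _ => ?_
      by_cases hu : u ∈ A
      · simp [hu, c]
      · simp [hu]
    rw [e]
    refine Finset.sum_le_sum fun v hv => ?_
    have e1 := hA v hv
    have e2 : ((G.neighborSet v ∩ A).ncard : ℝ) ≤
      (G.neighborSet v ∩ A ∩ T).ncard + 2 * (K * (2:ℕ)) := by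
      exact_mod_cast nbr_split (l := 2) (by norm_num) h2 h3 (hL v hv) A
    push_cast at e2
    linarith
  · rw [Finset.sum_comm]
    have e1 : p * ∑ v ∈ L, ∑ u, c v u ≤ ∑ v ∈ L, p * (deg G v : ℝ) := by
      rw [← Finset.mul_sum]
      exact mul_le_mul_of_nonneg_left (Finset.sum_le_sum fun v _ => hcd v) hp0
    have e2 : L.card * τ ≤ ∑ v ∈ L, ((deg G v : ℝ) / 2 - 2 * g v - 4 * K - p * deg G v) := by
      rw [← nsmul_eq_mul]
      exact Finset.card_nsmul_le_sum _ _ _ hτ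
    rw [Finset.sum_sub_distrib] at e2
    linarith
  · have e1 : ∑ u, (∑ v ∈ L, c v u) ^ 2 = ∑ v ∈ L, ∑ v' ∈ L, ∑ u, c v u * c v' u := by
      simp_rw [sq, Finset.sum_mul_sum]
      rw [Finset.sum_comm]
      refine Finset.sum_congr rfl fun v _ => ?_
      rw [Finset.sum_comm]
    rw [e1, ← nsmul_eq_mul]
    refine Finset.sum_le_card_nsmul _ _ _ fun v hv => ?_
    have e2 : ∀ v' ∈ L, ∑ u, c v u * c v' u ≤ (if v' = v then R else 0) + 1 := by
      intro v' hv'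
      have e3 : ∑ u, c v u * c v' u =
          ((G.neighborSet v ∩ G.neighborSet v' ∩ T).ncard : ℝ) := by
        rw [ncard_sum]
        refine Finset.sum_congr rfl fun u _ => ?_
        simp only [c, Set.mem_inter_iff]
        by_cases a : u ∈ G.neighborSet v <;> by_cases b : u ∈ G.neighborSet v' <;>
          by_cases d : u ∈ T <;> simp [a, b, d]
      split_ifs with h
      · subst h
        have : ∑ u, c v' u * c v' u = ∑ u, c v' u := by
          refine Finset.sum_congr rfl fun u _ => ?_
          simp only [c]; split_ifs <;> simp
        rw [this]
        linarith [hcd v', hR v' hv']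
      · rw [e3, zero_add]
        exact_mod_cast (h3.2 2 (by norm_num)).2.2.1 v (hL v hv) v' (hL v' hv') (Ne.symm h)
    refine (Finset.sum_le_sum e2).trans ?_
    rw [Finset.sum_add_distrib]
    simp [hv]

lemma single_bound {G : SimpleGraph V} {p : ℝ}
    (hp0 : 0 ≤ p) (hp1 : p ≤ 1) (g : ℝ) (v : V) (hd : 0 < deg G v)
    {τ : ℝ} (hτ0 : 0 ≤ τ) (hτ : τ ≤ (deg G v : ℝ) / 2 - 2 * g - p * deg G v) :
    prob p (fun A => (deg G v : ℝ) / 2 - 2 * g ≤ ((G.neighborSet v ∩ A).ncard : ℝ)) ≤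
      Real.exp (- (2 * τ ^ 2 / deg G v)) := by
  have e : ∑ u, (if u ∈ G.neighborSet v then (1:ℝ) else 0) = deg G v := (ncard_sum _).symm
  have main := prob_hoeff hp0 hp1 (fun u => if u ∈ G.neighborSet v then (1:ℝ) else 0) (t := τ)
    (S := (deg G v : ℝ) / 2 - 2 * g) (W := deg G v) (by rw [e]; linarith) hτ0
    (by exact_mod_cast hd) (by simp only [ite_pow, one_pow, zero_pow two_ne_zero]; rw [e])
  refine le_trans (prob_mono hp0 hp1 ?_) main
  intro A hA
  refine hA.trans (le_of_eq ?_)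
  rw [ncard_sum]
  refine Finset.sum_congr rfl fun u _ => ?_
  by_cases a : u ∈ G.neighborSet v <;> by_cases b : u ∈ A <;> simp only [Set.mem_inter_iff, a, b] <;> simp

def h1 (G : SimpleGraph V) (g : V → ℝ) (A : Set V) : Set V :=
  A ∪ {v | (deg G v : ℝ) / 2 - 2 * g v ≤ ((G.neighborSet v ∩ A).ncard : ℝ)}

def h2 (G : SimpleGraph V) (g : V → ℝ) (A : Set V) : Set V :=
  h1 G g A ∪ {v | (deg G v : ℝ) / 2 - g v ≤ ((G.neighborSet v ∩ h1 G g A).ncard : ℝ)}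

lemma percolates_imp (G : SimpleGraph V) (g : V → ℝ) (A : Set V) (h : Percolates G A) :
    h2 G g A = Set.univ ∨ ∃ x, x ∉ h2 G g A ∧
      (deg G x : ℝ) / 2 ≤ ((G.neighborSet x ∩ h2 G g A).ncard : ℝ) := by
  by_contra! hcon
  obtain ⟨hne, hx⟩ := hcon
  apply hne
  have hsub : ∀ i, bootIter G A i ⊆ h2 G g A := by
    intro i
    induction i with
    | zero => exact fun v hv => Or.inl (Or.inl hv)
    | succ i ih =>
      rintro v (hv | hv)
      · exact ih hv
      · by_contra hv2
        have h1 := hx v hv2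
        have h3 : (G.neighborSet v ∩ bootIter G A i).ncard ≤
            (G.neighborSet v ∩ h2 G g A).ncard :=
          Set.ncard_le_ncard (Set.inter_subset_inter_right _ ih) (Set.toFinite _)
        have h3' : ((G.neighborSet v ∩ bootIter G A i).ncard : ℝ) ≤
            (G.neighborSet v ∩ h2 G g A).ncard := by exact_mod_cast h3
        have h4 : (deg G v : ℝ) / 2 ≤ ((G.neighborSet v ∩ bootIter G A i).ncard : ℝ) := hv
        linarith
  rw [Percolates] at h
  rw [Set.eq_univ_iff_forall]
  intro v
  have : v ∈ ⋃ i, bootIter G A i := by rw [h]; trivial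
  obtain ⟨i, hi⟩ := Set.mem_iUnion.1 this
  exact hsub i hi

lemma ncard_diff_ge (N B C : Set V) (hBC : B ⊆ C) :
    ((N ∩ C).ncard : ℝ) = (N ∩ B).ncard + (N ∩ (C \ B)).ncard := by
  have : N ∩ C = (N ∩ B) ∪ (N ∩ (C \ B)) := by
    ext u
    simp only [Set.mem_inter_iff, Set.mem_union, Set.mem_sdiff]
    have := @hBC u
    tauto
  rw [this, Set.ncard_union_eq ?_ (Set.toFinite _) (Set.toFinite _)]
  · push_cast; rfl
  · rw [Set.disjoint_left]
    rintro u ⟨_, h1⟩ ⟨_, h2⟩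
    exact h2.2 h1

/-- a vertex newly infected in round two has many neighbours newly infected in round one -/
lemma new_two {G : SimpleGraph V} {g : V → ℝ} {A : Set V} {y : V} (hy : y ∈ h2 G g A)
    (hy1 : y ∉ h1 G g A) : g y < ((G.neighborSet y ∩ (h1 G g A \ A)).ncard : ℝ) := by
  have a1 : (deg G y : ℝ) / 2 - g y ≤ ((G.neighborSet y ∩ h1 G g A).ncard : ℝ) :=
    hy.resolve_left hy1
  have a2 : ((G.neighborSet y ∩ A).ncard : ℝ) < (deg G y : ℝ) / 2 - 2 * g y := by
    by_contra! hc
    exact hy1 (Or.inr hc)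
  have a3 := ncard_diff_ge (G.neighborSet y) A (h1 G g A) Set.subset_union_left
  linarith

lemma new_three {G : SimpleGraph V} {g : V → ℝ} {A : Set V} {x : V} (hx : x ∉ h2 G g A)
    (hx2 : (deg G x : ℝ) / 2 ≤ ((G.neighborSet x ∩ h2 G g A).ncard : ℝ)) :
    g x < ((G.neighborSet x ∩ (h2 G g A \ h1 G g A)).ncard : ℝ) := by
  have a2 : ((G.neighborSet x ∩ h1 G g A).ncard : ℝ) < (deg G x : ℝ) / 2 - g x := by
    by_contra! hc
    exact hx (Or.inr hc)
  have a3 := ncard_diff_ge (G.neighborSet x) (h1 G g A) (h2 G g A) Set.subset_union_left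
  linarith

lemma new_one {G : SimpleGraph V} {g : V → ℝ} {A : Set V} {v : V} (hv : v ∈ h1 G g A \ A) :
    (deg G v : ℝ) / 2 - 2 * g v ≤ ((G.neighborSet v ∩ A).ncard : ℝ) :=
  hv.1.resolve_left hv.2

lemma nbr_sphere {G : SimpleGraph V} {x y : V} (h : G.Adj x y) : y ∈ sphere G x 1 := by
  simp [sphere, SimpleGraph.edist_eq_one_iff_adj, h]

/-- the neighbourhood as a finset -/
noncomputable def nbF (G : SimpleGraph V) (v : V) : Finset V := (G.neighborSet v).toFinset

lemma card_nbF (G : SimpleGraph V) (v : V) : (nbF G v).card = deg G v := by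
  rw [nbF, deg, Set.ncard_eq_toFinset_card']

lemma mem_nbF {G : SimpleGraph V} {v u : V} : u ∈ nbF G v ↔ G.Adj v u := by
  simp [nbF]

/-- candidates for the leaf choices -/
noncomputable def fam (G : SimpleGraph V) (m : ℕ) (Y : Finset V) : Finset (V → Finset V) :=
  Fintype.piFinset (fun y => if y ∈ Y then (nbF G y).powersetCard m else {∅})

lemma tree_exists {K : ℕ} {G : SimpleGraph V} {x : V} {D : Set V}
    (hP2 : P2 K G) (h3 : P3At K G x D) (g : V → ℝ) (m : ℕ)
    (hgx : (m : ℝ) + 1 ≤ g x) (hgy : ∀ y, G.Adj x y → (m : ℝ) + m + 2 * K ≤ g y)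
    (A : Set V) (hx : x ∉ h2 G g A)
    (hx2 : (deg G x : ℝ) / 2 ≤ ((G.neighborSet x ∩ h2 G g A).ncard : ℝ)) :
    ∃ Y ∈ (nbF G x).powersetCard m, ∃ f ∈ fam G m Y,
      (∀ v ∈ Y.biUnion f, v ∈ sphere G x 2 \ D) ∧ (Y.biUnion f).card = m * m ∧
      ∀ v ∈ Y.biUnion f, (deg G v : ℝ) / 2 - 2 * g v ≤ ((G.neighborSet v ∩ A).ncard : ℝ) := by
  have b1 := new_three hx hx2
  -- remove D
  set C := G.neighborSet x ∩ (h2 G g A \ h1 G g A) with hC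
  have b2 : C.ncard ≤ (C \ D).ncard + 1 := by
    have c1 : C ⊆ (C \ D) ∪ (D ∩ sphere G x 1) := by
      intro y hy
      by_cases hD : y ∈ D
      · exact Or.inr ⟨hD, nbr_sphere hy.1⟩
      · exact Or.inl ⟨hy, hD⟩
    have c2 := Set.ncard_le_ncard c1 (Set.toFinite _)
    have c3 := Set.ncard_union_le (C \ D) (D ∩ sphere G x 1)
    have c4 := (h3.2 1 le_rfl).1
    simp only [Nat.sub_self, pow_zero, mul_one] at c4
    omega
  have b3 : m ≤ ((C \ D).toFinset).card := by
    rw [← Set.ncard_eq_toFinset_card']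
    have : (m : ℝ) ≤ (C \ D).ncard := by
      have : (C.ncard : ℝ) ≤ (C \ D).ncard + 1 := by exact_mod_cast b2
      linarith
    exact_mod_cast this
  obtain ⟨Y, hYs, hYc⟩ := Finset.exists_subset_card_eq b3
  have hY : ∀ y ∈ Y, y ∈ C ∧ y ∉ D := fun y hy => by simpa using hYs hy
  have hY1 : ∀ y ∈ Y, y ∈ sphere G x 1 \ D := fun y hy => ⟨nbr_sphere (hY y hy).1.1, (hY y hy).2⟩
  -- leaf candidate sets
  let M : V → Set V := fun y =>
    (G.neighborSet y ∩ (h1 G g A \ A) ∩ (sphere G x 2 \ D)) \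
      ⋃ y' ∈ Y.erase y, (G.neighborSet y' : Set V)
  have hM : ∀ y ∈ Y, m ≤ (M y).toFinset.card := by
    intro y hy
    rw [← Set.ncard_eq_toFinset_card']
    have c1 := new_two (hY y hy).1.2.1 (hY y hy).1.2.2
    have c2 := nbr_split (l := 1) le_rfl hP2 h3 (hY1 y hy) (h1 G g A \ A)
    have c3 := hgy y (hY y hy).1.1
    have c4 : (G.neighborSet y ∩ (h1 G g A \ A) ∩ (sphere G x 2 \ D)) ⊆
        M y ∪ ((Y.erase y).biUnion (fun y' =>
          (G.neighborSet y ∩ G.neighborSet y' ∩ (sphere G x 2 \ D)).toFinset) : Finset V) := by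
      intro v hv
      by_cases hc : v ∈ ⋃ y' ∈ Y.erase y, (G.neighborSet y' : Set V)
      · right
        simp only [Set.mem_iUnion] at hc
        obtain ⟨y', hy', hv'⟩ := hc
        simp only [Finset.coe_biUnion, Set.mem_iUnion]
        refine ⟨y', hy', ?_⟩
        simp only [Set.coe_toFinset]
        exact ⟨⟨hv.1.1, hv'⟩, hv.2⟩
      · exact Or.inl ⟨hv, hc⟩
    have c5 := Set.ncard_le_ncard c4 (Set.toFinite _)
    have c6 := Set.ncard_union_le (M y) ((Y.erase y).biUnion (fun y' =>
          (G.neighborSet y ∩ G.neighborSet y' ∩ (sphere G x 2 \ D)).toFinset) : Finset V)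
    rw [Set.ncard_coe_finset] at c6
    have c7 : ((Y.erase y).biUnion (fun y' =>
          (G.neighborSet y ∩ G.neighborSet y' ∩ (sphere G x 2 \ D)).toFinset)).card ≤
          (Y.erase y).card * 1 := by
      refine Finset.card_biUnion_le_card_mul _ _ _ fun y' hy' => ?_
      rw [← Set.ncard_eq_toFinset_card']
      exact (h3.2 1 le_rfl).2.2.1 y (hY1 y hy) y' (hY1 y' (Finset.mem_of_mem_erase hy'))
        (Finset.ne_of_mem_erase hy').symm
    have c8 : (Y.erase y).card ≤ m := hYc ▸ Finset.card_le_card (Finset.erase_subset _ _)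
    have c9 : m + m + 2 * K < (G.neighborSet y ∩ (h1 G g A \ A)).ncard := by
      have := c3.trans_lt c1
      exact_mod_cast this
    norm_num at c2
    omega
  have hex : ∀ y, ∃ s : Finset V, (y ∈ Y → s ⊆ (M y).toFinset ∧ s.card = m) ∧
      (y ∉ Y → s = ∅) := by
    intro y
    by_cases hy : y ∈ Y
    · obtain ⟨s, hs, hc⟩ := Finset.exists_subset_card_eq (hM y hy)
      exact ⟨s, fun _ => ⟨hs, hc⟩, fun h => absurd hy h⟩
    · exact ⟨∅, fun h => absurd h hy, fun _ => rfl⟩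
  choose f hf hf' using hex
  have hfM : ∀ y ∈ Y, ∀ v ∈ f y, v ∈ M y := fun y hy v hv => by
    simpa using (hf y hy).1 hv
  refine ⟨Y, ?_, f, ?_, ?_, ?_, ?_⟩
  · rw [Finset.mem_powersetCard]
    exact ⟨fun y hy => mem_nbF.2 (hY y hy).1.1, hYc⟩
  · rw [fam, Fintype.mem_piFinset]
    intro y
    by_cases hy : y ∈ Y
    · rw [if_pos hy, Finset.mem_powersetCard]
      exact ⟨fun v hv => mem_nbF.2 (hfM y hy v hv).1.1.1, (hf y hy).2⟩
    · simp [hy, hf' y hy]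
  · intro v hv
    obtain ⟨y, hy, hv⟩ := Finset.mem_biUnion.1 hv
    exact (hfM y hy v hv).1.2
  · rw [Finset.card_biUnion]
    · rw [Finset.sum_congr rfl fun y hy => (hf y hy).2, Finset.sum_const, hYc, smul_eq_mul]
    · intro y hy y' hy' hne
      rw [Function.onFun, Finset.disjoint_left]
      intro v hv hv'
      refine (hfM y hy v hv).2 ?_
      simp only [Set.mem_iUnion]
      exact ⟨y', Finset.mem_erase.2 ⟨hne.symm, hy'⟩, (hfM y' hy' v hv').1.1.1⟩
  · intro v hv
    obtain ⟨y, hy, hv⟩ := Finset.mem_biUnion.1 hv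
    exact new_one (hfM y hy v hv).1.1.2

lemma card_fam_le {G : SimpleGraph V} {m n : ℕ} {Y : Finset V} (hY : Y.card = m)
    (h : ∀ y ∈ Y, deg G y ≤ n) : (fam G m Y).card ≤ (n.choose m) ^ m := by
  rw [fam, Fintype.card_piFinset]
  have : ∀ y : V, (if y ∈ Y then (nbF G y).powersetCard m else {∅}).card =
      if y ∈ Y then (deg G y).choose m else 1 := by
    intro y; split_ifs <;> simp [card_nbF]
  simp_rw [this]
  rw [Finset.prod_ite_mem, Finset.univ_inter, ← hY]
  exact Finset.prod_le_pow_card _ _ _ fun y hy => Nat.choose_le_choose _ (h y hy)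

/-- union bound over trees -/
lemma bad_bound {K : ℕ} {G : SimpleGraph V} {x : V} {p : ℝ}
    (hp0 : 0 ≤ p) (hp1 : p ≤ 1)
    (hP1 : P1 K G) (hP2 : P2 K G) (hP3 : P3 K G) (g : V → ℝ) (m : ℕ) (hm : 0 < m)
    (hgx : (m : ℝ) + 1 ≤ g x) (hgy : ∀ y, G.Adj x y → (m : ℝ) + m + 2 * K ≤ g y)
    {τ R : ℝ} (hτ0 : 0 ≤ τ) (hR0 : 0 ≤ R)
    (hτ : ∀ v ∈ sphere G x 2, τ ≤ (deg G v : ℝ) / 2 - 2 * g v - 4 * K - p * deg G v)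
    (hR : ∀ v ∈ sphere G x 2, (deg G v : ℝ) ≤ R) :
    prob p (fun A => x ∉ h2 G g A ∧
      (deg G x : ℝ) / 2 ≤ ((G.neighborSet x ∩ h2 G g A).ncard : ℝ)) ≤
    ((deg G x).choose m : ℝ) * ((deg G x + K).choose m : ℝ) ^ m *
      Real.exp (- (2 * ((m * m : ℕ) * τ) ^ 2 / ((m * m : ℕ) * (R + (m * m : ℕ))))) := by
  obtain ⟨D, hD⟩ := hP3 x
  set b := Real.exp (- (2 * ((m * m : ℕ) * τ) ^ 2 / ((m * m : ℕ) * (R + (m * m : ℕ))))) with hb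
  let Q : (V → Finset V) → Finset V → Set V → Prop := fun f Y A =>
      (∀ v ∈ Y.biUnion f, v ∈ sphere G x 2 \ D) ∧ (Y.biUnion f).card = m * m ∧
      ∀ v ∈ Y.biUnion f, (deg G v : ℝ) / 2 - 2 * g v ≤ ((G.neighborSet v ∩ A).ncard : ℝ)
  have hQ : ∀ f Y, prob p (Q f Y) ≤ b := by
    intro f Y
    by_cases hc : (∀ v ∈ Y.biUnion f, v ∈ sphere G x 2 \ D) ∧ (Y.biUnion f).card = m * m
    · have := leaf_bound hp0 hp1 hP2 hD g (Y.biUnion f) hc.1 (by rw [hc.2]; positivity) hτ0 hR0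
        (fun v hv => hτ v (hc.1 v hv).1) (fun v hv => hR v (hc.1 v hv).1)
      rw [hc.2] at this
      exact (prob_mono hp0 hp1 fun A hA => hA.2.2).trans this
    · have : prob p (Q f Y) ≤ 0 := by
        rw [prob_eq]
        refine (Finset.sum_eq_zero fun A _ => ?_).le
        rw [if_neg]
        exact fun h => hc ⟨h.1, h.2.1⟩
      exact this.trans (Real.exp_pos _).le
  calc _ ≤ prob p (fun A => ∃ Y ∈ (nbF G x).powersetCard m, ∃ f ∈ fam G m Y, Q f Y A) :=
        prob_mono hp0 hp1 fun A hA => tree_exists hP2 hD g m hgx hgy A hA.1 hA.2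
    _ ≤ ∑ Y ∈ (nbF G x).powersetCard m, prob p (fun A => ∃ f ∈ fam G m Y, Q f Y A) :=
        prob_exists_le hp0 hp1 _ _
    _ ≤ ∑ Y ∈ (nbF G x).powersetCard m, ((deg G x + K).choose m : ℝ) ^ m * b := by
        refine Finset.sum_le_sum fun Y hY => ?_
        rw [Finset.mem_powersetCard] at hY
        refine (prob_exists_le hp0 hp1 _ _).trans ?_
        refine (Finset.sum_le_card_nsmul _ _ b fun f _ => hQ f Y).trans ?_
        rw [nsmul_eq_mul]
        refine mul_le_mul_of_nonneg_right ?_ (Real.exp_pos _).le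
        have : (fam G m Y).card ≤ ((deg G x + K).choose m) ^ m := by
          refine card_fam_le hY.2 fun y hy => ?_
          have := hP1 x 1 le_rfl y (nbr_sphere (mem_nbF.1 (hY.1 hy)))
          rw [abs_le] at this
          push_cast at this
          omega
        exact_mod_cast this
    _ = _ := by
        rw [Finset.sum_const, Finset.card_powersetCard, card_nbF, nsmul_eq_mul, mul_assoc]

lemma markov_nbr {p : ℝ} (hp0 : 0 ≤ p) (hp1 : p ≤ 1) (G : SimpleGraph V) (v : V)
    (S : Set V → Set V) {t : ℝ} (ht : 0 < t) :
    prob p (fun A => t ≤ ((G.neighborSet v ∩ S A).ncard : ℝ)) ≤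
      (∑ y ∈ nbF G v, prob p (fun A => y ∈ S A)) / t := by
  refine le_trans (prob_mono hp0 hp1 ?_)
    (prob_markov hp0 hp1 (nbF G v) (fun y A => y ∈ S A) ht)
  intro A h
  refine h.trans (le_of_eq ?_)
  rw [Set.ncard_eq_toFinset_card']
  congr 2
  ext u
  simp [mem_nbF]

lemma univ_bound {G : SimpleGraph V} {p : ℝ} (hp0 : 0 ≤ p) (hp1 : p ≤ 1) (g q : V → ℝ)
    (x : V) (hd : ∀ v, 0 < deg G v) (hg : ∀ v, 0 < g v) {B1 B2 : ℝ}
    (hq : ∀ v, prob p (fun A => (deg G v : ℝ) / 2 - 2 * g v ≤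
      ((G.neighborSet v ∩ A).ncard : ℝ)) ≤ q v)
    (hB1 : ∀ v, q v ≤ B1) (hB2 : ∀ y, (∑ z ∈ nbF G y, q z) / g y ≤ B2) :
    prob p (fun A => h2 G g A = Set.univ) ≤ B1 + 2 * (B1 + B2) := by
  have s1 : ∀ z, prob p (fun A => z ∈ h1 G g A \ A) ≤ q z := fun z =>
    (prob_mono hp0 hp1 fun A hA => new_one hA).trans (hq z)
  have s2 : ∀ y, prob p (fun A => y ∈ h2 G g A \ h1 G g A) ≤ B2 := by
    intro y
    refine le_trans (prob_mono hp0 hp1 (F := fun A =>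
      g y ≤ ((G.neighborSet y ∩ (h1 G g A \ A)).ncard : ℝ)) ?_) ?_
    · intro A hA
      exact (new_two hA.1 hA.2).le
    · refine (markov_nbr hp0 hp1 G y (fun A => h1 G g A \ A) (hg y)).trans
        (le_trans ?_ (hB2 y))
      exact div_le_div_of_nonneg_right (Finset.sum_le_sum fun z _ => s1 z) (hg y).le
  have s3 : ∀ y, prob p (fun A => y ∈ h2 G g A \ A) ≤ B1 + B2 := by
    intro y
    refine le_trans (prob_mono hp0 hp1 (F := fun A =>
      y ∈ h1 G g A \ A ∨ y ∈ h2 G g A \ h1 G g A) ?_) ?_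
    · intro A hA
      by_cases h : y ∈ h1 G g A
      · exact Or.inl ⟨h, hA.2⟩
      · exact Or.inr ⟨hA.1, h⟩
    · exact (prob_or_le hp0 hp1 _ _).trans (add_le_add ((s1 y).trans (hB1 y)) (s2 y))
  have hdx : (0:ℝ) < deg G x := by exact_mod_cast hd x
  refine le_trans (prob_mono hp0 hp1 (F := fun A =>
      (deg G x : ℝ) / 2 - 2 * g x ≤ ((G.neighborSet x ∩ A).ncard : ℝ) ∨
      (deg G x : ℝ) / 2 ≤ ((G.neighborSet x ∩ (h2 G g A \ A)).ncard : ℝ)) ?_) ?_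
  · intro A hA
    by_contra! hc
    have e := ncard_diff_ge (G.neighborSet x) A (h2 G g A) (fun v hv => Or.inl (Or.inl hv))
    have e2 : ((G.neighborSet x ∩ h2 G g A).ncard : ℝ) = deg G x := by
      rw [hA, Set.inter_univ, deg]
    linarith [hc.1, hc.2, hg x]
  · refine (prob_or_le hp0 hp1 _ _).trans (add_le_add ((hq x).trans (hB1 x)) ?_)
    refine (markov_nbr hp0 hp1 G x (fun A => h2 G g A \ A) (half_pos hdx)).trans ?_
    rw [div_le_iff₀ (by positivity)]
    refine (Finset.sum_le_card_nsmul _ _ _ fun y _ => s3 y).trans (le_of_eq ?_)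
    rw [card_nbF, nsmul_eq_mul]
    ring

lemma choose_bound (n m : ℕ) (hm : 0 < m) :
    (n.choose m : ℝ) ≤ (Real.exp 1 * n / m) ^ m := by
  have hm' : (0:ℝ) < m := by exact_mod_cast hm
  have h1 : (n.choose m : ℝ) ≤ (n:ℝ) ^ m / m.factorial := Nat.choose_le_pow_div m n
  have h2 : (m:ℝ) ^ m / m.factorial ≤ Real.exp m := Real.pow_div_factorial_le_exp m hm'.le m
  have h3 : (0:ℝ) < m.factorial := by positivity
  rw [div_le_iff₀ h3] at h2
  refine h1.trans ?_
  rw [div_pow, mul_pow, ← Real.exp_nat_mul, mul_one, div_le_div_iff₀ h3 (by positivity)]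
  have : (0:ℝ) ≤ (n:ℝ) ^ m := by positivity
  nlinarith

set_option maxHeartbeats 4000000 in
/-- all asymptotic inequalities -/
lemma asym (K : ℕ) (ε : ℝ) (hε : 0 < ε) (hε1 : ε ≤ 1) (d : ℕ)
    (hd : 200 * (K + 1) / ε ^ 3 ≤ Real.sqrt (Real.log d)) :
    ∃ m : ℕ, 0 < m ∧ (m : ℝ) + 1 ≤ ε * Real.sqrt d ∧
      (∀ e : ℕ, (d : ℝ) - K ≤ e → (m : ℝ) + m + 2 * K ≤ ε * Real.sqrt e) ∧
      (∀ (e : ℕ) (p : ℝ), (d : ℝ) - 2 * K ≤ e → (e : ℝ) ≤ d + 2 * K →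
        p ≤ 1 / 2 - (1 / 2 + ε) * Real.sqrt (Real.log d / d) →
        (1 / 2 + ε / 2) * Real.sqrt (d * Real.log d) ≤
          (e : ℝ) / 2 - 2 * (ε * Real.sqrt e) - 4 * K - p * e) ∧
      ((d.choose m : ℝ) * ((d + K).choose m : ℝ) ^ m *
        Real.exp (- (2 * ((m * m : ℕ) * ((1 / 2 + ε / 2) * Real.sqrt (d * Real.log d))) ^ 2 /
          ((m * m : ℕ) * ((d + 2 * K : ℝ) + (m * m : ℕ))))) ≤ Real.exp (-((K + 1) * d))) := by
  have hK : (0:ℝ) ≤ K := by positivity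
  set D : ℝ := (d : ℝ) with hDdef
  set l := Real.log D with hl
  set r := Real.sqrt D with hr
  set sl := Real.sqrt l with hsl
  have hε3 : 0 < ε ^ 3 := by positivity
  have a1 : 200 * (K + 1) ≤ sl * ε ^ 3 := by rwa [div_le_iff₀ hε3] at hd
  have hεle : ε ^ 3 ≤ 1 := pow_le_one₀ hε.le hε1
  have hsl0 : 0 ≤ sl := Real.sqrt_nonneg _
  have hsl1 : 1 ≤ sl := by nlinarith
  have hl0 : 0 < l := by
    by_contra! h
    rw [hsl, Real.sqrt_eq_zero_of_nonpos h] at hsl1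
    linarith
  have hsl2 : sl ^ 2 = l := Real.sq_sqrt hl0.le
  have hsll : sl ≤ l := by nlinarith
  have hD0 : 0 < D := by
    rcases (Nat.cast_nonneg d : (0:ℝ) ≤ d).eq_or_lt with h | h
    · rw [hl, hDdef, ← h] at hl0; simp at hl0
    · exact h
  have hlD : l ≤ D := (Real.log_le_sub_one_of_pos hD0).trans (by linarith)
  have hslr : sl ≤ r := Real.sqrt_le_sqrt hlD
  have hr2 : r ^ 2 = D := Real.sq_sqrt hD0.le
  have hr0 : 0 ≤ r := Real.sqrt_nonneg _
  have hr1 : 1 ≤ r := hsl1.trans hslr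
  have hrD : r ≤ D := by nlinarith
  have he2 : ε ^ 2 ≤ ε := by nlinarith
  have he3 : ε ^ 3 ≤ ε ^ 2 := by nlinarith [sq_nonneg ε]
  have a2 : 200 * (K + 1) ≤ r * ε ^ 3 := a1.trans (by gcongr)
  have a3 : 200 * (K + 1) ≤ l * ε ^ 3 := a1.trans (by gcongr)
  have a4 : 200 * (K + 1) ≤ r * ε ^ 2 := a2.trans (by gcongr)
  have a5 : 200 * (K + 1) ≤ r * ε := a4.trans (by gcongr)
  have a6 : 200 * (K + 1) ≤ sl * ε := a1.trans (by gcongr; linarith)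
  have a7 : 200 * (K + 1) ≤ l * ε ^ 2 := a3.trans (by gcongr)
  have a8 : 200 * (K + 1) ≤ D * ε := a5.trans (by gcongr)
  set m := ⌊ε * r / 3⌋₊ with hm
  have m1 : (m : ℝ) ≤ ε * r / 3 := Nat.floor_le (by positivity)
  have m2 : ε * r / 3 < m + 1 := Nat.lt_floor_add_one _
  have m3 : ε * r / 4 ≤ m := by linarith
  have m4 : (0:ℝ) < m := by linarith
  have m5 : 0 < m := by exact_mod_cast m4
  refine ⟨m, m5, by linarith, ?_, ?_, ?_⟩
  · intro e he
    have : r ≤ Real.sqrt e + K := by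
      rw [hr]
      refine Real.sqrt_le_iff.2 ⟨by positivity, ?_⟩
      have h1 : Real.sqrt e ^ 2 = e := Real.sq_sqrt (by positivity)
      have h2 : (0:ℝ) ≤ Real.sqrt e := Real.sqrt_nonneg _
      have h3 : (K:ℝ) ≤ K ^ 2 := by exact_mod_cast Nat.le_self_pow two_ne_zero K
      nlinarith
    have : ε * (r - K) ≤ ε * Real.sqrt e := by gcongr; linarith
    nlinarith
  · intro e p he1 he2 hp
    have e1 : Real.sqrt (l / D) = sl / r := Real.sqrt_div hl0.le _
    have e2 : Real.sqrt (D * l) = r * sl := Real.sqrt_mul hD0.le _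
    rw [e1] at hp
    rw [e2]
    have e3 : Real.sqrt e ≤ 2 * r := by
      refine Real.sqrt_le_iff.2 ⟨by positivity, ?_⟩
      nlinarith
    have e4 : 0 ≤ sl / r := by positivity
    have e5 : sl / r ≤ 1 := by rw [div_le_one (by linarith)]; exact hslr
    have e6 : D * (sl / r) = r * sl := by
      rw [← hr2]; field_simp
    have e7 : (1/2 + ε) * ((D - 2 * K) * (sl / r)) ≤ (1/2 - p) * e := by
      have h1 : (1/2 + ε) * (sl / r) ≤ 1/2 - p := by linarith
      have h2 : (0:ℝ) ≤ e := by positivity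
      have h3 : 0 ≤ (1/2 + ε) * (sl / r) := by positivity
      calc _ = ((1/2 + ε) * (sl / r)) * (D - 2 * K) := by ring
        _ ≤ ((1/2 + ε) * (sl / r)) * e := by gcongr
        _ ≤ _ := by gcongr
    have e8 : r * sl - 2 * K ≤ (D - 2 * K) * (sl / r) := by
      rw [sub_mul, e6]
      have : 2 * K * (sl / r) ≤ 2 * K := mul_le_of_le_one_right (by positivity) e5
      linarith
    have e9 : (1/2 + ε) * (r * sl - 2 * K) ≤ (1/2 - p) * e := le_trans (by gcongr) e7
    have e10 : 200 * (K + 1) * r ≤ sl * ε * r := by gcongr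
    have e11 : ε * Real.sqrt e ≤ 1 * (2 * r) := by gcongr
    have e12 : (K:ℝ) ≤ K * r := le_mul_of_one_le_right hK hr1
    have e13 : ε * K ≤ K := mul_le_of_le_one_left hK hε1
    linarith
  · have n1 : ((m * m : ℕ) : ℝ) = m ^ 2 := by push_cast; ring
    rw [n1]
    set N : ℝ := (m:ℝ) ^ 2 with hN
    have hN0 : 0 < N := by positivity
    have hN1 : N ≤ ε * D / 9 := by
      have : N ≤ (ε * r / 3) ^ 2 := by rw [hN]; gcongr
      nlinarith
    have hN2 : ε ^ 2 * D / 16 ≤ N := by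
      have : (ε * r / 4) ^ 2 ≤ N := by rw [hN]; gcongr
      nlinarith
    have hs : Real.sqrt (D * l) ^ 2 = D * l := Real.sq_sqrt (by positivity)
    have x1 : N * ((1 + ε) / 2) * l ≤ 2 * (N * ((1 / 2 + ε / 2) * Real.sqrt (D * l))) ^ 2 /
          (N * ((D + 2 * K) + N)) := by
      rw [le_div_iff₀ (by positivity), mul_pow, mul_pow, hs]
      have : D + 2 * K + N ≤ (1 + ε) * D := by nlinarith
      calc N * ((1 + ε) / 2) * l * (N * ((D + 2 * K) + N)) ≤
          N * ((1 + ε) / 2) * l * (N * ((1 + ε) * D)) := by gcongr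
        _ = _ := by ring
    have x2 : (d.choose m : ℝ) ≤ Real.exp (m * l) := by
      have : (d.choose m : ℝ) ≤ D ^ m := by
        rw [hDdef]; exact_mod_cast Nat.choose_le_pow d m
      refine this.trans (le_of_eq ?_)
      rw [Real.exp_nat_mul, Real.exp_log hD0]
    have x3 : ((d + K).choose m : ℝ) ≤ Real.exp (m * (l / 2 + ε / 8 * l)) := by
      refine (choose_bound _ _ m5).trans ?_
      rw [Real.exp_nat_mul]
      gcongr
      rw [Real.exp_add]
      have y1 : Real.exp (l / 2) = r := by
        rw [hr, Real.sqrt_eq_rpow, Real.rpow_def_of_pos hD0]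
        congr 1; ring
      have y2 : 24 / ε ≤ Real.exp (ε / 8 * l) := by
        have h1 := Real.add_one_le_exp (ε / 8 * l)
        refine le_trans ?_ h1
        rw [div_le_iff₀ hε]
        nlinarith
      rw [y1, div_le_iff₀ m4]
      have y3 : Real.exp 1 ≤ 3 := Real.exp_one_lt_d9.le.trans (by norm_num)
      have y4 : ((d + K : ℕ) : ℝ) ≤ 2 * D := by
        push_cast
        have : D * ε ≤ D := by nlinarith
        linarith
      calc Real.exp 1 * ((d + K : ℕ) : ℝ) ≤ 3 * (2 * D) := by gcongr
        _ = r * (24 / ε) * (ε * r / 4) := by rw [← hr2]; field_simp; ring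
        _ ≤ _ := by gcongr
    have x4 : ((d + K).choose m : ℝ) ^ m ≤ Real.exp (N * (l / 2 + ε / 8 * l)) := by
      calc _ ≤ Real.exp (m * (l / 2 + ε / 8 * l)) ^ m := by gcongr
        _ = _ := by rw [← Real.exp_nat_mul]; congr 1; rw [hN]; ring
    calc _ ≤ Real.exp (m * l) * Real.exp (N * (l / 2 + ε / 8 * l)) *
          Real.exp (-(N * ((1 + ε) / 2) * l)) := by gcongr
      _ = Real.exp (m * l + N * (l / 2 + ε / 8 * l) - N * ((1 + ε) / 2) * l) := by
          rw [← Real.exp_add, ← Real.exp_add]; congr 1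
      _ ≤ _ := by
          apply Real.exp_le_exp.2
          have z1 : m * l ≤ ε / 8 * N * l := by
            gcongr
            have : 8 ≤ ε * m := by nlinarith
            rw [hN]; nlinarith
          have z2 : (K + 1) * D ≤ ε / 4 * N * l := by
            calc (K + 1) * D ≤ (l * ε ^ 3 / 64) * D := by
                  gcongr; linarith
              _ = ε / 4 * (ε ^ 2 * D / 16) * l := by ring
              _ ≤ _ := by gcongr
          linarith

lemma phi_bound (K : ℕ) (ε : ℝ) (hε : 0 < ε) (hε1 : ε ≤ 1) (G : SimpleGraph V)
    (hP1 : P1 K G) (hP2 : P2 K G) (hP3 : P3 K G) (hP5 : P5 K G) (x0 : V)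
    (hd : 200 * (K + 1) / ε ^ 3 ≤ Real.sqrt (Real.log (minDeg G)))
    {p : ℝ} (hp0 : 0 ≤ p) (hp1 : p ≤ 1)
    (hp : p ≤ 1 / 2 - (1 / 2 + ε) * Real.sqrt (Real.log (minDeg G) / minDeg G)) :
    Phi p G ≤ Real.exp (-(minDeg G : ℝ)) + (Real.exp (-(1 / 2 * Real.log (minDeg G))) +
      2 * (Real.exp (-(1 / 2 * Real.log (minDeg G))) +
        1 / ε * Real.exp (1 - ε / 2 * Real.log (minDeg G)))) := by
  set δ := minDeg G with hδ
  have hdeg : ∀ v, δ ≤ deg G v := fun v => Nat.sInf_le ⟨v, rfl⟩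
  have hX : 200 * ((K:ℝ) + 1) ≤ 200 * (K + 1) / ε ^ 3 := by
    rw [le_div_iff₀ (by positivity)]
    have : ε ^ 3 ≤ 1 := pow_le_one₀ hε.le hε1
    have hK : (0:ℝ) ≤ K := by positivity
    nlinarith
  have hKn : (0:ℝ) ≤ K := by positivity
  have hs1 : 200 * ((K:ℝ) + 1) ≤ Real.sqrt (Real.log δ) := hX.trans hd
  have hl1 : 200 * ((K:ℝ) + 1) ≤ Real.log δ := by
    have h0 : 0 ≤ Real.log δ := by
      by_contra! h
      rw [Real.sqrt_eq_zero_of_nonpos h.le] at hs1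
      linarith
    have := Real.sq_sqrt h0
    nlinarith
  have hδ0 : (0:ℝ) < δ := by
    rcases (Nat.cast_nonneg δ : (0:ℝ) ≤ δ).eq_or_lt with h | h
    · rw [← h] at hl1; simp at hl1; linarith
    · exact h
  have hδl : Real.log δ ≤ δ := (Real.log_le_sub_one_of_pos hδ0).trans (by linarith)
  have hδe : Real.exp 1 ≤ δ := by
    rw [← Real.le_log_iff_exp_le hδ0]; linarith
  have hdegR : ∀ v, (δ:ℝ) ≤ deg G v := fun v => by exact_mod_cast hdeg v
  have hlog : ∀ v, Real.log δ ≤ Real.log (deg G v) := fun v => Real.log_le_log hδ0 (hdegR v)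
  have hbig : ∀ v, 200 * (K + 1) / ε ^ 3 ≤ Real.sqrt (Real.log (deg G v)) := fun v =>
    hd.trans (Real.sqrt_le_sqrt (hlog v))
  have hpv : ∀ v, p ≤ 1 / 2 - (1 / 2 + ε) *
      Real.sqrt (Real.log (deg G v) / deg G v) := by
    intro v
    refine hp.trans ?_
    have : Real.log (deg G v) / deg G v ≤ Real.log δ / δ :=
      Real.log_div_self_antitoneOn hδe (hδe.trans (hdegR v)) (hdegR v)
    have := Real.sqrt_le_sqrt this
    gcongr
  have hd0 : ∀ v, 0 < deg G v := fun v => by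
    have := hδ0.trans_le (hdegR v)
    exact_mod_cast this
  let g : V → ℝ := fun v => ε * Real.sqrt (deg G v)
  have hg : ∀ v, 0 < g v := fun v => by
    have : (0:ℝ) < deg G v := by exact_mod_cast hd0 v
    positivity
  -- the bad vertices
  have hbad : ∀ x, prob p (fun A => x ∉ h2 G g A ∧
      (deg G x : ℝ) / 2 ≤ ((G.neighborSet x ∩ h2 G g A).ncard : ℝ)) ≤
      Real.exp (-((K + 1) * δ)) := by
    intro x
    obtain ⟨m, hm, b1, b2, b3, b4⟩ := asym K ε hε hε1 (deg G x) (hbig x)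
    have hs2 : ∀ v ∈ sphere G x 2, (deg G x : ℝ) - 2 * K ≤ deg G v ∧
        (deg G v : ℝ) ≤ deg G x + 2 * K := by
      intro v hv
      have := hP1 x 2 (by norm_num) v hv
      rw [abs_le] at this
      push_cast at this
      have h1 : deg G x ≤ deg G v + 2 * K := by omega
      have h2 : deg G v ≤ deg G x + 2 * K := by omega
      refine ⟨?_, by exact_mod_cast h2⟩
      have : (deg G x : ℝ) ≤ deg G v + 2 * K := by exact_mod_cast h1
      linarith
    refine (bad_bound hp0 hp1 hP1 hP2 hP3 g m hm b1 ?_ (by positivity)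
      (by positivity : (0:ℝ) ≤ deg G x + 2 * K)
      (fun v hv => b3 (deg G v) p (hs2 v hv).1 (hs2 v hv).2 (hpv x))
      (fun v hv => (hs2 v hv).2)).trans (b4.trans ?_)
    · intro y hy
      refine b2 _ ?_
      have := hP1 x 1 le_rfl y (nbr_sphere hy)
      rw [abs_le] at this
      push_cast at this
      have h1 : deg G x ≤ deg G y + K := by omega
      have : (deg G x : ℝ) ≤ deg G y + K := by exact_mod_cast h1
      linarith
    · apply Real.exp_le_exp.2
      have := mul_le_mul_of_nonneg_left (hdegR x) (by positivity : (0:ℝ) ≤ K + 1)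
      linarith
  -- single vertices
  let q : V → ℝ := fun v => Real.exp (-((1 + ε) / 2 * Real.log (deg G v)))
  have hq : ∀ v, prob p (fun A => (deg G v : ℝ) / 2 - 2 * g v ≤
      ((G.neighborSet v ∩ A).ncard : ℝ)) ≤ q v := by
    intro v
    obtain ⟨m, hm, b1, b2, b3, b4⟩ := asym K ε hε hε1 (deg G v) (hbig v)
    have b5 := b3 (deg G v) p (by linarith) (by linarith) (hpv v)
    refine (single_bound hp0 hp1 (g v) v (hd0 v)
      (τ := (1 / 2 + ε / 2) * Real.sqrt (deg G v * Real.log (deg G v))) (by positivity)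
      (by simp only [g]; linarith)).trans ?_
    apply Real.exp_le_exp.2
    have hD : (0:ℝ) < deg G v := by exact_mod_cast hd0 v
    have hL : 0 ≤ Real.log (deg G v) := by linarith [hlog v]
    rw [mul_pow, Real.sq_sqrt (by positivity), neg_le_neg_iff, le_div_iff₀ hD]
    have : (1 + ε) / 2 ≤ 2 * (1 / 2 + ε / 2) ^ 2 := by nlinarith
    calc (1 + ε) / 2 * Real.log (deg G v) * deg G v
        ≤ (2 * (1 / 2 + ε / 2) ^ 2) * Real.log (deg G v) * deg G v := by gcongr
      _ = _ := by ring
  have huniv := univ_bound hp0 hp1 g q x0 hd0 hg (B1 := Real.exp (-(1 / 2 * Real.log δ)))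
    (B2 := 1 / ε * Real.exp (1 - ε / 2 * Real.log δ)) hq ?_ ?_
  · unfold Phi
    refine (prob_mono hp0 hp1 fun A hA => percolates_imp G g A hA).trans ?_
    refine (prob_or_le hp0 hp1 _ _).trans ?_
    rw [add_comm]
    refine add_le_add ?_ huniv
    have e1 := prob_exists_le hp0 hp1 (Finset.univ : Finset V) (fun x A => x ∉ h2 G g A ∧
      (deg G x : ℝ) / 2 ≤ ((G.neighborSet x ∩ h2 G g A).ncard : ℝ))
    refine (prob_mono hp0 hp1 fun A hA => ?_).trans (e1.trans
      ((Finset.sum_le_card_nsmul _ _ _ fun x _ => hbad x).trans ?_))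
    · obtain ⟨x, hx⟩ := hA
      exact ⟨x, Finset.mem_univ _, hx⟩
    · rw [nsmul_eq_mul, Finset.card_univ]
      have h5 : (Fintype.card V : ℝ) ≤ Real.exp (K * δ) := by
        have := hP5
        rw [P5, Nat.card_eq_fintype_card] at this
        exact this
      calc (Fintype.card V : ℝ) * Real.exp (-((K + 1) * δ)) ≤
          Real.exp (K * δ) * Real.exp (-((K + 1) * δ)) := by gcongr
        _ = _ := by rw [← Real.exp_add]; congr 1; ring
  · intro v
    apply Real.exp_le_exp.2
    have := hlog v
    nlinarith
  · intro y
    have hD : (0:ℝ) < deg G y := by exact_mod_cast hd0 y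
    have hK : 2 * (K:ℝ) ≤ deg G y := by linarith [hdegR y]
    set D : ℝ := (deg G y : ℝ) with hDd
    have y1 : Real.sqrt D = Real.exp (Real.log D / 2) := by
      rw [Real.sqrt_eq_rpow, Real.rpow_def_of_pos hD]
      congr 1; ring
    have hz : ∀ z ∈ nbF G y, q z ≤ Real.exp (-((1 + ε) / 2 * (Real.log D - Real.log 2))) := by
      intro z hz
      apply Real.exp_le_exp.2
      rw [neg_le_neg_iff]
      gcongr
      rw [← Real.log_div hD.ne' (by norm_num)]
      refine Real.log_le_log (by positivity) ?_
      have := hP1 y 1 le_rfl z (nbr_sphere (mem_nbF.1 hz))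
      rw [abs_le] at this
      push_cast at this
      have h1 : deg G y ≤ deg G z + K := by omega
      have : (deg G y : ℝ) ≤ deg G z + K := by exact_mod_cast h1
      linarith
    have hsum := Finset.sum_le_card_nsmul _ _ _ hz
    rw [card_nbF, nsmul_eq_mul, ← hDd] at hsum
    refine (div_le_div_of_nonneg_right hsum (hg y).le).trans ?_
    have e1 : g y = ε * Real.exp (Real.log D / 2) := by simp only [g]; rw [← hDd, y1]
    have e2 : D * Real.exp (-((1 + ε) / 2 * (Real.log D - Real.log 2))) =
        Real.exp (Real.log D - ((1 + ε) / 2 * (Real.log D - Real.log 2))) := by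
      rw [sub_eq_add_neg (Real.log D) ((1 + ε) / 2 * _), Real.exp_add, Real.exp_log hD]
    rw [e1, e2, div_mul_eq_div_div_swap, ← Real.exp_sub, one_div_mul_eq_div]
    refine div_le_div_of_nonneg_right (Real.exp_le_exp.2 ?_) hε.le
    have := hlog y
    rw [← hDd] at this
    have h2 := Real.log_two_lt_d9
    have h3 := Real.log_pos (by norm_num : (1:ℝ) < 2)
    have h4 : ε * Real.log 2 ≤ Real.log 2 := mul_le_of_le_one_left h3.le hε1
    have h5 : ε * Real.log δ ≤ ε * Real.log D := mul_le_mul_of_nonneg_left this hε.le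
    linarith

end helpers

lemma InH_props {K : ℕ} {V : Type} [Finite V] {G : SimpleGraph V} (h : InH K G)
    (hd : 0 < minDeg G) : P1 K G ∧ P2 K G ∧ P3 K G ∧ P5 K G := by
  have key : Nat.card V ≠ 1 := by
    intro hc
    obtain ⟨hs, ⟨x⟩⟩ := Nat.card_eq_one_iff_unique.1 hc
    have h1 : minDeg G ≤ deg G x := Nat.sInf_le ⟨x, rfl⟩
    have h2 : G.neighborSet x = ∅ := by
      ext y
      simp only [SimpleGraph.mem_neighborSet, Set.mem_empty_iff_false, iff_false]
      intro hy
      exact hy.ne (Subsingleton.elim _ _)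
    rw [deg, h2, Set.ncard_empty] at h1
    omega
  obtain ⟨n, hn⟩ := h
  cases n with
  | zero => exact absurd hn key
  | succ n =>
    rcases hn with hn | ⟨a, b, c, _, e⟩
    · exact absurd hn key
    · exact ⟨a, b, c, e⟩

/-- 0-statement of the main theorem. -/
theorem statement1 (K : ℕ) (ε : ℝ) (hε : 0 < ε)
    (V : ℕ → Type) (hfin : ∀ n, Finite (V n))
    (G : ∀ n, SimpleGraph (V n))
    (hH : ∀ n, InH K (G n))
    (hδ : Tendsto (fun n => minDeg (G n)) atTop atTop)
    (p : ℕ → ℝ) (hp : ∀ n, p n ∈ Set.Icc (0 : ℝ) 1)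
    (hhigh : ∀ n, p n < 1 / 2 - (1 / 2 + ε) *
        Real.sqrt (Real.log (minDeg (G n)) / (minDeg (G n)))) :
    Tendsto (fun n => Phi (p n) (G n)) atTop (nhds 0) := by
  classical
  set e := min ε 1 with he
  have he0 : 0 < e := lt_min hε one_pos
  have he1 : e ≤ 1 := min_le_right _ _
  have heε : e ≤ ε := min_le_left _ _
  have hδR : Tendsto (fun n => (minDeg (G n) : ℝ)) atTop atTop :=
    tendsto_natCast_atTop_atTop.comp hδ
  have hlog : Tendsto (fun n => Real.log (minDeg (G n) : ℝ)) atTop atTop :=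
    Real.tendsto_log_atTop.comp hδR
  have hsq : Tendsto (fun n => Real.sqrt (Real.log (minDeg (G n) : ℝ))) atTop atTop :=
    Real.tendsto_sqrt_atTop.comp hlog
  have t1 : Tendsto (fun n => Real.exp (-(minDeg (G n) : ℝ))) atTop (nhds 0) :=
    Real.tendsto_exp_neg_atTop_nhds_zero.comp hδR
  have t2 : Tendsto (fun n => Real.exp (-(1 / 2 * Real.log (minDeg (G n))))) atTop (nhds 0) :=
    Real.tendsto_exp_neg_atTop_nhds_zero.comp (hlog.const_mul_atTop (by norm_num))
  have t3 : Tendsto (fun n => Real.exp (1 - e / 2 * Real.log (minDeg (G n)))) atTop (nhds 0) := by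
    refine Real.tendsto_exp_atBot.comp ?_
    refine tendsto_atBot_add_const_left _ 1 ?_
    exact tendsto_neg_atTop_atBot.comp (hlog.const_mul_atTop (by positivity))
  have t4 := t1.add (t2.add ((t2.add (t3.const_mul (1 / e))).const_mul 2))
  simp only [mul_zero, add_zero] at t4
  refine tendsto_of_tendsto_of_tendsto_of_le_of_le' tendsto_const_nhds t4 ?_ ?_
  · refine Eventually.of_forall fun n => ?_
    have := Fintype.ofFinite (V n)
    exact prob_nonneg (hp n).1 (hp n).2 _
  · filter_upwards [hsq.eventually_ge_atTop (200 * (K + 1) / e ^ 3), hδ.eventually_gt_atTop 0]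
      with n h1 h2
    have := Fintype.ofFinite (V n)
    obtain ⟨a, b, c, d⟩ := InH_props (hH n) h2
    have hne : Nonempty (V n) := by
      by_contra hc
      rw [not_nonempty_iff] at hc
      have : minDeg (G n) = 0 := by
        rw [minDeg, Set.range_eq_empty, Nat.sInf_empty]
      omega
    refine phi_bound K e he0 he1 (G n) a b c d hne.some h1 (hp n).1 (hp n).2
      ((hhigh n).le.trans ?_)
    gcongr

end MBP
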